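/- (Generalized Miura transform is injective.) Assume e is even, i.e. g(i) = 0 for every odd i; set p := ⊕_{i ≥ 0} g(i) and m := ⊕_{i < 0} g(i). Since ⊕_{i > 0} g(i) is a Lie ideal of p, the Lie algebra projection p → g(0) induces an algebra homomorphism U(p) → U(g(0)), where U(p) ⊆ U is the subalgebra generated by p. Then the restriction of this homomorphism to the subspace W := {u ∈ U(p) : [ξ,u] ∈ U·m_χ for all ξ ∈ m} is injective. -/

import Mathlib

/-- The zero weight space `g(0) = ker(ad h)` as a Lie subalgebra of `g`. -/
noncomputable def gZero
    (K : Type*) [Field K]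
    (g : Type*) [LieRing g] [LieAlgebra K g]
    (h : g) : LieSubalgebra K g :=
  { Module.End.eigenspace (LieAlgebra.ad K g h) ((0 : ℤ) : K) with
    lie_mem' := by
      intro x y hx hy
      replace hx : x ∈ Module.End.eigenspace (LieAlgebra.ad K g h) ((0 : ℤ) : K) := hx
      replace hy : y ∈ Module.End.eigenspace (LieAlgebra.ad K g h) ((0 : ℤ) : K) := hy
      show ⁅x, y⁆ ∈ Module.End.eigenspace (LieAlgebra.ad K g h) ((0 : ℤ) : K)
      rw [Module.End.mem_eigenspace_iff] at hx hy ⊢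
      simp only [Int.cast_zero, zero_smul, LieAlgebra.ad_apply] at hx hy ⊢
      rw [leibniz_lie, hx, hy]
      simp }

section
open Module
section Sl2
variable {K V : Type*} [Field K] [CharZero K] [AddCommGroup V] [Module K V]

lemma gm_mono {W : K → Submodule K V} {S T : Set K} (h : S ⊆ T) {x : V}
    (hx : x ∈ ⨆ j ∈ S, W j) : x ∈ ⨆ j ∈ T, W j :=
  (biSup_mono h : ⨆ j ∈ S, W j ≤ ⨆ j ∈ T, W j) hx

lemma gm_shift (H : End K V) (P : Submodule K V) (S : Set K) (k : K)
    (hk : k ∉ S) (v : V) (hv : v ∈ P)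
    (h : H v - k • v ∈ ⨆ j ∈ S, (End.eigenspace H j ⊓ P)) :
    v ∈ ⨆ j ∈ insert k S, (End.eigenspace H j ⊓ P) := by
  have key : ∀ w ∈ ⨆ j ∈ S, (End.eigenspace H j ⊓ P),
      ∃ w' ∈ ⨆ j ∈ S, (End.eigenspace H j ⊓ P), H w' - k • w' = w := by
    intro w hw
    induction hw using Submodule.iSup_induction' with
    | mem j x hx =>
      by_cases hj : j ∈ S
      · simp only [hj, iSup_pos] at hx
        have hjk : j - k ≠ 0 := by
          intro h0
          exact hk (by rwa [← sub_eq_zero.mp h0])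
        refine ⟨(j - k)⁻¹ • x, Submodule.smul_mem _ _
          (Submodule.mem_iSup_of_mem j (by simpa only [hj, iSup_pos] using hx)), ?_⟩
        have := End.mem_eigenspace_iff.mp hx.1
        rw [map_smul, this, smul_smul, smul_smul, ← sub_smul]
        have : (j - k)⁻¹ * j - k * (j - k)⁻¹ = 1 := by field_simp
        rw [this, one_smul]
      · simp only [hj, iSup_neg, not_false_eq_true, Submodule.mem_bot] at hx
        exact ⟨0, zero_mem _, by simp [hx]⟩
    | zero => exact ⟨0, zero_mem _, by simp⟩
    | add x y _ _ hx hy =>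
      obtain ⟨a, ha, ha'⟩ := hx
      obtain ⟨b, hb, hb'⟩ := hy
      refine ⟨a + b, add_mem ha hb, ?_⟩
      rw [← ha', ← hb', map_add, smul_add]; abel
  obtain ⟨w, hw, hw'⟩ := key _ h
  have hle : ⨆ j ∈ S, (End.eigenspace H j ⊓ P) ≤ ⨆ j ∈ insert k S, (End.eigenspace H j ⊓ P) :=
    biSup_mono fun i hi => Set.mem_insert_of_mem _ hi
  have hwP : w ∈ P := (iSup₂_le fun j _ => inf_le_right : _ ≤ P) hw
  have : v - w ∈ ⨆ j ∈ insert k S, (End.eigenspace H j ⊓ P) := by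
    refine Submodule.mem_iSup_of_mem k (Submodule.mem_iSup_of_mem (Set.mem_insert _ _) ⟨?_, sub_mem hv hwP⟩)
    refine End.mem_eigenspace_iff.mpr ?_
    rw [map_sub, smul_sub, sub_eq_sub_iff_sub_eq_sub]
    exact hw'.symm
  simpa using add_mem this (hle hw)

variable [FiniteDimensional K V]

lemma gm_nilp (H X : End K V) (c : K) (hc : c ≠ 0) (h : H * X - X * H = c • X) :
    IsNilpotent X := by
  have h1 : ∀ k : ℕ, H * X ^ k - X ^ k * H = (k * c) • X ^ k := by
    intro k
    induction k with
    | zero => simp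
    | succ k ih =>
      have : H * X ^ (k+1) - X ^ (k+1) * H =
        (H * X ^ k - X ^ k * H) * X + X ^ k * (H * X - X * H) := by
          rw [pow_succ]; noncomm_ring
      rw [this, ih, h, smul_mul_assoc, mul_smul_comm, ← pow_succ, ← add_smul]
      push_cast; ring_nf
  by_contra hn
  have hn' : ∀ k, X ^ k ≠ 0 := fun k hk => hn ⟨k, hk⟩
  have := End.eigenvectors_linearIndependent' (LinearMap.mulLeft K H - LinearMap.mulRight K H)
    (fun k : ℕ => (k : K) * c) (fun a b hab => by simpa [hc] using hab) (fun k => X ^ k)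
    (fun k => ⟨by rw [End.mem_eigenspace_iff]; simpa using h1 k, hn' k⟩)
  exact Infinite.not_finite (α := ℕ) this.finite

variable [IsAlgClosed K]

lemma gm_sl2_diag (E F H : End K V) (hE : H * E - E * H = (2 : K) • E)
    (hF : H * F - F * H = (-2 : K) • F) (hEF : E * F - F * E = H) :
    ⨆ i : ℤ, End.eigenspace H (i : K) = ⊤ := by
  obtain ⟨NE, hNE⟩ := gm_nilp H E 2 two_ne_zero hE
  obtain ⟨NF, hNF⟩ := gm_nilp H F (-2) (by simp) hF
  have hE' : ∀ v, H (E v) = E (H v) + (2 : K) • E v := fun v => by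
    have := LinearMap.congr_fun hE v
    simp only [LinearMap.sub_apply, End.mul_apply, LinearMap.smul_apply] at this
    rw [← this]; abel
  have hF' : ∀ v, H (F v) = F (H v) - (2 : K) • F v := fun v => by
    have := LinearMap.congr_fun hF v
    simp only [LinearMap.sub_apply, End.mul_apply, LinearMap.smul_apply] at this
    rw [neg_smul] at this
    rw [sub_eq_add_neg, ← this]; abel
  have hEF' : ∀ v, E (F v) = F (E v) + H v := fun v => by
    have := LinearMap.congr_fun hEF v
    simp only [LinearMap.sub_apply, End.mul_apply] at this
    rw [← this]; abel
  have hHF : ∀ (k : ℕ) v, H ((F ^ k) v) = (F ^ k) (H v) - (2 * k : K) • (F ^ k) v := by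
    intro k v
    induction k with
    | zero => simp
    | succ k ih =>
      rw [pow_succ', End.mul_apply, End.mul_apply, hF', ih]
      simp only [map_sub, map_smul]
      push_cast; module
  have hHE : ∀ (k : ℕ) v, H ((E ^ k) v) = (E ^ k) (H v) + (2 * k : K) • (E ^ k) v := by
    intro k v
    induction k with
    | zero => simp
    | succ k ih =>
      rw [pow_succ', End.mul_apply, End.mul_apply, hE', ih]
      simp only [map_add, map_smul]
      push_cast; module
  have hA : ∀ (k : ℕ) v, E v = 0 →
      E ((F ^ (k+1)) v) = ((k:K)+1) • (F ^ k) (H v - (k:K) • v) := by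
    intro k v hv
    induction k with
    | zero => simp [hEF', hv]
    | succ k ih =>
      rw [pow_succ', End.mul_apply, hEF', ih, hHF]
      rw [pow_succ', End.mul_apply, End.mul_apply, End.mul_apply]
      simp only [map_sub, map_smul]
      push_cast; module
  -- primitive vectors
  have hprim : ∀ P : Submodule K V, (∀ x ∈ P, H x ∈ P) → (∀ x ∈ P, E x = 0) →
      ∀ k : ℕ, ∀ v ∈ P, (F ^ k) v = 0 →
      v ∈ ⨆ j ∈ {j : K | ∃ n : ℕ, n < k ∧ j = n}, (End.eigenspace H j ⊓ P) := by
    intro P hPH hPE k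
    induction k with
    | zero => intro v _ hv; simp at hv; simp [hv]
    | succ k ih =>
      intro v hv hFv
      have h1 : H v - (k:K) • v ∈ P := sub_mem (hPH v hv) (P.smul_mem _ hv)
      have h2 : (F ^ k) (H v - (k:K) • v) = 0 := by
        have := hA k v (hPE v hv)
        rw [hFv, map_zero, eq_comm, smul_eq_zero] at this
        exact this.resolve_left (Nat.cast_add_one_ne_zero k)
      have := gm_shift H P _ (k : K) (by rintro ⟨n, hn, h⟩; norm_cast at h; omega) v hv
        (ih _ h1 h2)
      refine gm_mono ?_ this
      rintro i (rfl | ⟨n, hn, rfl⟩)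
      · exact ⟨k, by omega, rfl⟩
      · exact ⟨n, by omega, rfl⟩
  let C : End K V := (4:K) • (F * E) + (2:K) • H + H * H
  have hCv : ∀ v, C v = (4:K) • F (E v) + (2:K) • H v + H (H v) := fun v => rfl
  have hCH : Commute C H := by
    ext v
    simp only [End.mul_apply, hCv, map_add, map_smul, hF', hE']
    module
  have hCE : Commute C E := by
    ext v
    simp only [End.mul_apply, hCv, map_add, map_smul, hE', hEF']
    module
  rw [eq_top_iff, ← End.iSup_maxGenEigenspace_eq_top C]
  refine iSup_le fun c => ?_
  set Vc := End.maxGenEigenspace C c with hVc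
  have hVH : ∀ x ∈ Vc, H x ∈ Vc := End.mapsTo_maxGenEigenspace_of_comm hCH c
  have hVE : ∀ x ∈ Vc, E x ∈ Vc := End.mapsTo_maxGenEigenspace_of_comm hCE c
  let P := LinearMap.ker E ⊓ Vc
  have hPH : ∀ x ∈ P, H x ∈ P := fun x hx => ⟨by
    have h0 : E x = 0 := hx.1
    have := hE' x
    simp only [h0, map_zero, smul_zero, add_zero] at this
    exact this.symm, hVH x hx.2⟩
  have hcj : ∀ j : ℕ, End.eigenspace H (j:K) ⊓ P ≠ ⊥ → c = j ^ 2 + 2 * j := by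
    intro j hj
    obtain ⟨v, hv, hv0⟩ := Submodule.exists_mem_ne_zero_of_ne_bot hj
    have h1 := End.mem_eigenspace_iff.mp hv.1
    have h2 : E v = 0 := hv.2.1
    obtain ⟨k, hk⟩ := (End.mem_maxGenEigenspace C c v).mp hv.2.2
    have h3 : ∀ k : ℕ, ((C - c • (1 : End K V)) ^ k) v = ((j:K) ^ 2 + 2 * j - c) ^ k • v := by
      intro k
      induction k with
      | zero => simp
      | succ k ih =>
        rw [pow_succ', End.mul_apply, ih, map_smul]
        simp only [LinearMap.sub_apply, hCv, h2, h1, map_smul, LinearMap.smul_apply,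
          End.one_apply, map_zero]
        module
    rw [h3, smul_eq_zero] at hk
    have h4 := eq_zero_of_pow_eq_zero (hk.resolve_right hv0)
    exact (sub_eq_zero.mp h4).symm
  obtain ⟨n, hn⟩ : ∃ n : ℕ, P ≤ End.eigenspace H (n : K) := by
    by_cases hex : ∃ n : ℕ, End.eigenspace H (n:K) ⊓ P ≠ ⊥
    · obtain ⟨n, hn⟩ := hex
      refine ⟨n, fun x hx => ?_⟩
      have := hprim P hPH (fun x hx => hx.1) NF x hx (by rw [hNF]; rfl)
      refine (iSup₂_le ?_ : _ ≤ End.eigenspace H (n:K)) this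
      rintro _ ⟨m, _, rfl⟩
      by_cases hm : End.eigenspace H (m:K) ⊓ P = ⊥
      · rw [hm]; exact bot_le
      · have h1 := (hcj n hn).symm.trans (hcj m hm)
        have h2 : n ^ 2 + 2 * n = m ^ 2 + 2 * m := by exact_mod_cast h1
        have h3 : n = m := by nlinarith
        rw [h3]; exact inf_le_left
    · push Not at hex
      refine ⟨0, fun x hx => ?_⟩
      have := hprim P hPH (fun x hx => hx.1) NF x hx (by rw [hNF]; rfl)
      refine (iSup₂_le ?_ : _ ≤ End.eigenspace H _) this
      rintro _ ⟨m, _, rfl⟩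
      rw [hex m]; exact bot_le
  have hfin : ∀ k : ℕ, ∀ x ∈ Vc, (E ^ k) x = 0 →
      x ∈ ⨆ j ∈ {j : K | ∃ m : ℕ, m < k ∧ j = (n:K) - 2 * m}, (End.eigenspace H j ⊓ ⊤) := by
    intro k
    induction k with
    | zero => intro v _ hv; simp at hv; simp [hv]
    | succ k ih =>
      intro x hx hEx
      have hpow : ∀ k : ℕ, (E ^ k) x ∈ Vc := by
        intro k
        induction k with
        | zero => simpa
        | succ k ih => rw [pow_succ', End.mul_apply]; exact hVE _ ih
      have h1 : (E ^ k) x ∈ P :=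
        ⟨by rw [pow_succ', End.mul_apply] at hEx; exact hEx, hpow k⟩
      have h2 := End.mem_eigenspace_iff.mp (hn h1)
      rw [hHE] at h2
      have h3 : (E ^ k) (H x - ((n:K) - 2 * k) • x) = 0 := by
        rw [map_sub, map_smul, sub_smul, ← h2]; abel
      have := gm_shift H ⊤ _ ((n:K) - 2 * k) (by
        rintro ⟨m, hm, h⟩
        have h' : (k:K) = m := by
          have : (2:K) * k = 2 * m := by linear_combination -h
          exact mul_left_cancel₀ two_ne_zero this
        norm_cast at h'; omega) x trivial
        (ih _ (sub_mem (hVH x hx) (Vc.smul_mem _ hx)) h3)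
      refine gm_mono ?_ this
      rintro i (rfl | ⟨m, hm, rfl⟩)
      · exact ⟨k, by omega, rfl⟩
      · exact ⟨m, by omega, rfl⟩
  intro x hx
  have := hfin NE x hx (by rw [hNE]; rfl)
  refine (iSup₂_le ?_ : _ ≤ ⨆ i : ℤ, End.eigenspace H (i : K)) this
  rintro _ ⟨m, _, rfl⟩
  refine inf_le_left.trans ?_
  have := le_iSup (fun i : ℤ => End.eigenspace H (i : K)) ((n:ℤ) - 2 * m)
  push_cast at this
  exact this
end Sl2
end

section
open Module
section Test
attribute [local instance] LieRing.ofAssociativeRing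
variable {K : Type*} [Field K]

/-- product of affine letters -/
noncomputable def gmWord {g : Type*} [LieRing g] [LieAlgebra K g] (l : List (g × K)) :
    UniversalEnvelopingAlgebra K g :=
  (l.map fun a => UniversalEnvelopingAlgebra.ι K a.1 + algebraMap K _ a.2).prod

lemma gm_der_pow {R : Type*} [CommRing R] [Algebra K R] (J : Ideal R) (D : Derivation K R R) (n : ℕ) :
    ∀ x ∈ J ^ (n + 1), D x ∈ J ^ n := by
  induction n with
  | zero => intro x _; simp
  | succ n ih =>
    intro x hx
    rw [pow_succ J (n+1)] at hx
    induction hx using Submodule.mul_induction_on' with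
    | mem_mul_mem a ha b hb =>
      rw [Derivation.leibniz, smul_eq_mul, smul_eq_mul]
      refine add_mem (Ideal.mul_mem_right _ _ ha) ?_
      rw [pow_succ, mul_comm b]
      exact Ideal.mul_mem_mul (ih a ha) hb
    | add a _ b _ ha hb => rw [map_add]; exact add_mem ha hb

lemma gm_symbol {R : Type*} [CommRing R] [Algebra K R] (J : Ideal R) (r : R) (hr : r ∈ J) (n : ℕ)
    (l : List (Derivation K R R × K)) (hl : l.length ≤ n) :
    (l.map fun a => (a.1 : R →ₗ[K] R) + algebraMap K (End K R) a.2).prod (r ^ n)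
      - (n.descFactorial l.length : R) * (r ^ (n - l.length) * (l.map fun a => a.1 r).prod)
      ∈ J ^ (n - l.length + 1) := by
  induction l with
  | nil => simp
  | cons a l ih =>
    have hl' : l.length + 1 ≤ n := hl
    obtain ⟨k, hk⟩ : ∃ k, n - l.length = k + 1 := ⟨n - l.length - 1, by omega⟩
    have hk' : n - (l.length + 1) = k := by omega
    have ih := ih (by omega)
    rw [hk] at ih
    simp only [List.length_cons, List.map_cons, List.prod_cons, hk', End.mul_apply]
    set w := (l.map fun a => (a.1 : R →ₗ[K] R) + algebraMap K (End K R) a.2).prod (r ^ n)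
    set q := (l.map fun a => a.1 r).prod
    rw [Nat.descFactorial_succ, hk]
    obtain ⟨z, hz, hwz⟩ : ∃ z ∈ J ^ (k+1+1), w = (n.descFactorial l.length : R) * (r ^ (k+1) * q) + z :=
      ⟨_, ih, by ring⟩
    have h1 : a.1 w = (n.descFactorial l.length : R) * ((k+1 : ℕ) * r ^ k * a.1 r * q + r ^ (k+1) * a.1 q)
        + a.1 z := by
      rw [hwz]
      simp only [map_add, Derivation.leibniz, Derivation.leibniz_pow, smul_eq_mul,
        Derivation.map_natCast, nsmul_eq_mul, Nat.add_sub_cancel]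
      ring
    have h2 : r ^ (k+1) ∈ J ^ (k+1) := Ideal.pow_mem_pow hr _
    have h3 : w ∈ J ^ (k+1) := by
      rw [hwz]
      exact add_mem (Ideal.mul_mem_left _ _ (Ideal.mul_mem_right _ _ h2))
        (Ideal.pow_le_pow_right (by omega) hz)
    have h4 : a.2 • w ∈ J ^ (k+1) := by
      rw [Algebra.smul_def]; exact Ideal.mul_mem_left _ _ h3
    have h5 := gm_der_pow J a.1 (k+1) z hz
    simp only [LinearMap.add_apply, Module.algebraMap_end_apply, Derivation.coeFn_coe]
    rw [h1]
    have : (n.descFactorial l.length : R) * ((k+1 : ℕ) * r ^ k * a.1 r * q + r ^ (k+1) * a.1 q)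
        + a.1 z + a.2 • w - (((k+1) * n.descFactorial l.length : ℕ) : R) * (r ^ k * (a.1 r * q))
        = (n.descFactorial l.length : R) * (r ^ (k+1) * a.1 q) + a.1 z + a.2 • w := by
      push_cast; ring
    rw [this]
    exact add_mem (add_mem (Ideal.mul_mem_left _ _ (Ideal.mul_mem_right _ _ h2)) h5) h4

variable {g : Type*} [LieRing g] [LieAlgebra K g] [FiniteDimensional K g]

lemma gm_exists_rep [LieAlgebra.IsKilling K g] (lam : Dual K g) :
    ∃ (ι : Type) (D : g →ₗ⁅K⁆ Derivation K (MvPolynomial ι K) (MvPolynomial ι K))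
      (ev : MvPolynomial ι K →ₐ[K] K) (r : MvPolynomial ι K),
      ev r = 0 ∧ ∀ x, ev (D x r) = lam x := by
  let β := Module.finBasis K (End K g)
  let L : End K g →ₗ[K] MvPolynomial (Fin (finrank K (End K g))) K :=
    β.constr K (fun i => MvPolynomial.X i)
  have hL : ∀ i, L (β i) = MvPolynomial.X i := fun i => β.constr_basis K _ i
  let D0 : g →ₗ[K] Derivation K (MvPolynomial (Fin (finrank K (End K g))) K)
     (MvPolynomial (Fin (finrank K (End K g))) K) :=
    { toFun := fun x => MvPolynomial.mkDerivation K (fun i => L (LieAlgebra.ad K g x * β i))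
      map_add' := by
        intro x y
        ext i : 2
        simp [add_mul]
      map_smul' := by
        intro c x
        ext i : 2
        simp }
  have hD0X : ∀ x i, D0 x (MvPolynomial.X i) = L (LieAlgebra.ad K g x * β i) := fun x i => by
    simp [D0]
  have hD0 : ∀ x T, D0 x (L T) = L (LieAlgebra.ad K g x * T) := by
    intro x T
    have : (D0 x : _ →ₗ[K] _) ∘ₗ L = L ∘ₗ LinearMap.mulLeft K (LieAlgebra.ad K g x) := by
      refine β.ext fun i => ?_
      simp [hL, hD0X]
    exact LinearMap.congr_fun this T
  let D : g →ₗ⁅K⁆ Derivation K (MvPolynomial (Fin (finrank K (End K g))) K)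
     (MvPolynomial (Fin (finrank K (End K g))) K) :=
    { D0 with
      map_lie' := by
        intro x y
        refine MvPolynomial.derivation_ext fun i => ?_
        change D0 ⁅x, y⁆ (MvPolynomial.X i) = ⁅D0 x, D0 y⁆ (MvPolynomial.X i)
        rw [Derivation.commutator_apply, hD0X, hD0X, hD0X, hD0, hD0, ← map_sub, LieHom.map_lie,
          LieRing.of_associative_ring_bracket, sub_mul, mul_assoc, mul_assoc] }
  let ev : MvPolynomial (Fin (finrank K (End K g))) K →ₐ[K] K :=
    MvPolynomial.aeval (fun i => LinearMap.trace K g (β i))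
  have hev : ∀ T, ev (L T) = LinearMap.trace K g T := by
    intro T
    have : ev.toLinearMap ∘ₗ L = LinearMap.trace K g := by
      refine β.ext fun i => ?_
      simp [hL, ev]
    exact LinearMap.congr_fun this T
  obtain ⟨z, hz⟩ : ∃ z, ∀ x, killingForm K g x z = lam x := by
    have hnd := LieAlgebra.IsKilling.killingForm_nondegenerate K g
    refine ⟨(LinearMap.BilinForm.toDual (killingForm K g) hnd).symm lam, fun x => ?_⟩
    rw [LieModule.traceForm_comm]
    exact LinearMap.BilinForm.apply_toDual_symm_apply lam x
  refine ⟨_, D, ev, L (LieAlgebra.ad K g z) - algebraMap K _ (LinearMap.trace K g (LieAlgebra.ad K g z)),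
    by rw [map_sub, hev, AlgHom.commutes]; simp, fun x => ?_⟩
  change ev (D0 x _) = _
  rw [map_sub, Derivation.map_algebraMap, sub_zero, hD0, hev, ← hz, killingForm_apply_apply]
  rfl

lemma gm_test [LieAlgebra.IsKilling K g] (lam : Dual K g) (n : ℕ) :
    ∃ T : UniversalEnvelopingAlgebra K g →ₗ[K] K, ∀ l : List (g × K),
      (l.length < n → T (gmWord l) = 0) ∧
      (l.length = n → T (gmWord l) = n.factorial * (l.map fun a => lam a.1).prod) := by
  obtain ⟨ι, D, ev, r, hr, hD⟩ := gm_exists_rep lam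
  let ρ0 : g →ₗ⁅K⁆ End K (MvPolynomial ι K) :=
    { toFun := fun x => (D x : _ →ₗ[K] _)
      map_add' := by intro x y; rw [map_add]; rfl
      map_smul' := by intro x y; rw [map_smul]; rfl
      map_lie' := by
        intro x y
        rw [LieHom.map_lie, Derivation.commutator_coe_linear_map] }
  let ρ := UniversalEnvelopingAlgebra.lift K ρ0
  have hρ : ∀ x, ρ (UniversalEnvelopingAlgebra.ι K x) = (D x : _ →ₗ[K] _) :=
    fun x => UniversalEnvelopingAlgebra.lift_ι_apply K ρ0 x
  let T : UniversalEnvelopingAlgebra K g →ₗ[K] K :=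
    ev.toLinearMap ∘ₗ (LinearMap.applyₗ (r ^ n)) ∘ₗ ρ.toLinearMap
  have hT : ∀ u, T u = ev (ρ u (r ^ n)) := fun u => rfl
  have hw : ∀ l : List (g × K), ρ (gmWord l) =
      ((l.map fun a => (D a.1, a.2)).map
        fun a => (a.1 : _ →ₗ[K] _) + algebraMap K (End K (MvPolynomial ι K)) a.2).prod := by
    intro l
    rw [gmWord, map_list_prod, List.map_map, List.map_map]
    congr 1
    refine List.map_congr_left fun a _ => ?_
    simp only [Function.comp_apply, map_add, hρ, AlgHom.commutes]
  refine ⟨T, fun l => ?_⟩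
  have key := fun h => gm_symbol (RingHom.ker ev) r hr n (l.map fun a => (D a.1, a.2)) h
  simp only [← hw, List.length_map] at key
  constructor
  · intro h
    have := key h.le
    have h1 := Ideal.pow_le_self (by omega) this
    rw [RingHom.mem_ker, map_sub, sub_eq_zero] at h1
    rw [hT, h1]
    have : n - l.length ≠ 0 := by omega
    simp [map_mul, map_pow, hr, this]
  · intro h
    have := key h.le
    have h1 := Ideal.pow_le_self (by omega) this
    rw [RingHom.mem_ker, map_sub, sub_eq_zero] at h1
    rw [hT, h1, h]
    simp [map_mul, map_list_prod, Nat.descFactorial_self, Function.comp_def, hD]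
end Test
end

section
open Module
section Reorder
variable {K : Type*} [Field K] {ι : Type*} [LinearOrder ι] {B : Type*} [Ring B] [Algebra K B]

/-- span of sorted words, bounded length -/
def gmS (K : Type*) [Field K] {ι : Type*} [LinearOrder ι] {B : Type*} [Ring B] [Algebra K B]
    (y : ι → B) (Z : Set ι) (fl : Prop) (n : ℕ) : Submodule K B :=
  Submodule.span K {v | ∃ l : List ι, l.Pairwise (· ≤ ·) ∧ (∀ i ∈ l, i ∈ Z) ∧ l.length ≤ n ∧
    (fl → l ≠ []) ∧ v = (l.map y).prod}

/-- span of sorted words -/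
def gmSS (K : Type*) [Field K] {ι : Type*} [LinearOrder ι] {B : Type*} [Ring B] [Algebra K B]
    (y : ι → B) (Z : Set ι) (fl : Prop) : Submodule K B :=
  Submodule.span K {v | ∃ l : List ι, l.Pairwise (· ≤ ·) ∧ (∀ i ∈ l, i ∈ Z) ∧
    (fl → l ≠ []) ∧ v = (l.map y).prod}

variable {y : ι → B} {Z : Set ι} {fl : Prop}

lemma gmS_mono {m n : ℕ} (h : m ≤ n) : gmS K y Z fl m ≤ gmS K y Z fl n :=
  Submodule.span_mono fun _ ⟨l, h1, h2, h3, h4⟩ => ⟨l, h1, h2, h3.trans h, h4⟩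

lemma gmS_le (n : ℕ) : gmS K y Z fl n ≤ gmSS K y Z fl :=
  Submodule.span_mono fun _ ⟨l, h1, h2, _, h4⟩ => ⟨l, h1, h2, h4⟩

lemma gm_oi (n : ℕ) (i : ι) (hi : i ∈ Z) (l : List ι) (hl : l.Pairwise (· ≤ ·))
    (hZ : ∀ i ∈ l, i ∈ Z) (hn : l.length ≤ n) :
    ((l.orderedInsert (· ≤ ·) i).map y).prod ∈ gmS K y Z fl (n + 1) := by
  refine Submodule.subset_span ⟨_, hl.orderedInsert _ _, ?_, ?_, ?_, rfl⟩
  · intro j hj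
    rw [List.mem_orderedInsert] at hj
    rcases hj with rfl | hj
    · exact hi
    · exact hZ j hj
  · rw [List.orderedInsert_length]; omega
  · intro _ h
    have := congrArg List.length h
    rw [List.orderedInsert_length] at this
    simp at this

lemma gm_insert (hy : ∀ i ∈ Z, ∀ j ∈ Z, ∃ a ∈ Submodule.span K (y '' Z), ∃ c : K,
      y i * y j - y j * y i = a + algebraMap K B c ∧ (fl → c = 0)) (n : ℕ) :
    ∀ i ∈ Z, ∀ l : List ι, l.Pairwise (· ≤ ·) → (∀ i ∈ l, i ∈ Z) → l.length ≤ n →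
      y i * (l.map y).prod - ((l.orderedInsert (· ≤ ·) i).map y).prod ∈ gmS K y Z fl n := by
  induction n with
  | zero =>
    intro i _ l _ _ hl
    rw [List.length_eq_zero_iff.mp (Nat.le_zero.mp hl)]
    simp
  | succ n ih =>
    intro i hi l hl hZ hlen
    -- left multiplication
    have hmul : ∀ k ∈ Z, ∀ v ∈ gmS K y Z fl n, y k * v ∈ gmS K y Z fl (n+1) := by
      intro k hk v hv
      induction hv using Submodule.span_induction with
      | mem v hv =>
        obtain ⟨l', h1, h2, h3, h4, rfl⟩ := hv
        have := add_mem (gmS_mono (Nat.le_succ n) (ih k hk l' h1 h2 h3))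
          (gm_oi (K := K) (y := y) (fl := fl) n k hk l' h1 h2 h3)
        simpa using this
      | zero => simp
      | add a b _ _ ha hb => rw [mul_add]; exact add_mem ha hb
      | smul c a _ ha => rw [mul_smul_comm]; exact Submodule.smul_mem _ _ ha
    cases l with
    | nil => simp
    | cons j t =>
      by_cases hij : i ≤ j
      · simp [List.orderedInsert_cons, hij]
      · have hj : j ∈ Z := hZ j (by simp)
        have ht : t.Pairwise (· ≤ ·) := (List.pairwise_cons.mp hl).2
        have htZ : ∀ i ∈ t, i ∈ Z := fun i hi => hZ i (by simp [hi])
        have htn : t.length ≤ n := by simpa using hlen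
        simp only [List.orderedInsert_cons, hij, if_false, List.map_cons, List.prod_cons]
        obtain ⟨a, ha, c, hac, hc⟩ := hy i hi j hj
        have h1 := hmul j hj _ (ih i hi t ht htZ htn)
        have h2 : a * (t.map y).prod ∈ gmS K y Z fl (n+1) := by
          clear hac
          induction ha using Submodule.span_induction with
          | mem v hv =>
            obtain ⟨k, hk, rfl⟩ := hv
            have := add_mem (gmS_mono (Nat.le_succ n) (ih k hk t ht htZ htn))
              (gm_oi (K := K) (y := y) (fl := fl) n k hk t ht htZ htn)
            simpa using this
          | zero => simp
          | add a b _ _ ha hb => rw [add_mul]; exact add_mem ha hb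
          | smul c a _ ha => rw [smul_mul_assoc]; exact Submodule.smul_mem _ _ ha
        have h3 : algebraMap K B c * (t.map y).prod ∈ gmS K y Z fl (n+1) := by
          by_cases hc0 : c = 0
          · simp [hc0]
          · rw [← Algebra.smul_def]
            exact Submodule.smul_mem _ _ (Submodule.subset_span
              ⟨t, ht, htZ, by omega, fun h => absurd (hc h) hc0, rfl⟩)
        have := add_mem h1 (add_mem h2 h3)
        rw [← add_mul, ← hac] at this
        convert this using 1
        noncomm_ring

lemma gm_mulS (hy : ∀ i ∈ Z, ∀ j ∈ Z, ∃ a ∈ Submodule.span K (y '' Z), ∃ c : K,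
      y i * y j - y j * y i = a + algebraMap K B c ∧ (fl → c = 0)) (i : ι) (hi : i ∈ Z) (v : B)
    (hv : v ∈ gmSS K y Z fl) : y i * v ∈ gmSS K y Z fl := by
  induction hv using Submodule.span_induction with
  | mem v hv =>
    obtain ⟨l', h1, h2, h4, rfl⟩ := hv
    have := add_mem (gmS_le _ (gm_insert hy l'.length i hi l' h1 h2 le_rfl))
      (gmS_le _ (gm_oi (K := K) (y := y) (fl := fl) _ i hi l' h1 h2 le_rfl))
    simpa using this
  | zero => simp
  | add a b _ _ ha hb => rw [mul_add]; exact add_mem ha hb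
  | smul c a _ ha => rw [mul_smul_comm]; exact Submodule.smul_mem _ _ ha

/-- the subalgebra of elements preserving a subspace by left multiplication -/
def gmStab (S : Submodule K B) : Subalgebra K B where
  carrier := {a | ∀ v ∈ S, a * v ∈ S}
  mul_mem' := fun {a b} ha hb v hv => by rw [mul_assoc]; exact ha _ (hb _ hv)
  add_mem' := fun {a b} ha hb v hv => by rw [add_mul]; exact add_mem (ha _ hv) (hb _ hv)
  algebraMap_mem' := fun c v hv => by rw [← Algebra.smul_def]; exact S.smul_mem _ hv

lemma gm_adjoin_le (hy : ∀ i ∈ Z, ∀ j ∈ Z, ∃ a ∈ Submodule.span K (y '' Z), ∃ c : K,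
      y i * y j - y j * y i = a + algebraMap K B c) (G : Set B)
    (hG : ∀ x ∈ G, ∃ a ∈ Submodule.span K (y '' Z), ∃ c : K, x = a + algebraMap K B c) :
    ∀ u ∈ Algebra.adjoin K G, u ∈ gmSS K y Z False := by
  intro u hu
  have hle : Algebra.adjoin K G ≤ gmStab (gmSS K y Z False) := by
    refine Algebra.adjoin_le fun x hx => ?_
    obtain ⟨a, ha, c, rfl⟩ := hG x hx
    refine add_mem ?_ (Subalgebra.algebraMap_mem _ c)
    have : Submodule.span K (y '' Z) ≤ Subalgebra.toSubmodule (gmStab (gmSS K y Z False)) := by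
      rw [Submodule.span_le]
      rintro _ ⟨i, hi, rfl⟩ v hv
      refine gm_mulS (fun i hi j hj => ?_) i hi v hv
      obtain ⟨a, ha, c, h⟩ := hy i hi j hj
      exact ⟨a, ha, c, h, False.elim⟩
    exact this ha
  have := hle hu 1 (Submodule.subset_span ⟨[], by simp⟩)
  simpa using this
end Reorder

lemma gm_adjoin_top (K g : Type*) [Field K] [LieRing g] [LieAlgebra K g] :
    Algebra.adjoin K (Set.range (UniversalEnvelopingAlgebra.ι K : g → _)) = ⊤ := by
  have h1 : (Set.range (UniversalEnvelopingAlgebra.ι K : g → _)) =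
      UniversalEnvelopingAlgebra.mkAlgHom K g '' (Set.range (TensorAlgebra.ι K : g → _)) := by
    rw [← Set.range_comp]
    rfl
  rw [h1, ← AlgHom.map_adjoin, TensorAlgebra.adjoin_range_ι, Algebra.map_top,
    AlgHom.range_eq_top]
  exact RingCon.mkₐ_surjective (α := K) _

end

section
open Module
section Sigma
open MvPolynomial
variable {K : Type*} [Field K] {ι : Type*} [LinearOrder ι] {B : Type*} [Ring B] [Algebra K B]

/-- sorted list of a monomial -/
noncomputable def gmSort (s : ι →₀ ℕ) : List ι := (Finsupp.toMultiset s).sort (· ≤ ·)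

/-- ordered product map -/
noncomputable def gmSig (K : Type*) [Field K] {ι : Type*} [LinearOrder ι] {B : Type*} [Ring B]
    [Algebra K B] (y : ι → B) : MvPolynomial ι K →ₗ[K] B :=
  (MvPolynomial.basisMonomials ι K).constr K (fun s => ((gmSort s).map y).prod)

variable (y : ι → B)

lemma gmSig_monomial (s : ι →₀ ℕ) (c : K) :
    gmSig K y (monomial s c) = c • ((gmSort s).map y).prod := by
  have : monomial s c = c • (MvPolynomial.basisMonomials ι K s) := by
    simp [MvPolynomial.smul_monomial]
  rw [this, map_smul, gmSig, Basis.constr_basis]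

lemma gmSort_length (s : ι →₀ ℕ) : (gmSort s).length = s.degree := by
  rw [gmSort, Multiset.length_sort, Finsupp.card_toMultiset]
  rfl

lemma gmSort_mem (s : ι →₀ ℕ) (i : ι) : i ∈ gmSort s ↔ i ∈ s.support := by
  rw [gmSort, Multiset.mem_sort, Finsupp.mem_toMultiset]

lemma gmSort_of_sorted (l : List ι) (hl : l.Pairwise (· ≤ ·)) :
    gmSort (Multiset.toFinsupp (l : Multiset ι)) = l := by
  rw [gmSort, Multiset.toFinsupp_toMultiset]
  refine List.Perm.eq_of_pairwise (le := (· ≤ ·)) (fun a b _ _ => le_antisymm)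
    (Multiset.pairwise_sort _ _) hl ?_
  rw [← Multiset.coe_eq_coe, Multiset.sort_eq]

lemma gmSort_prod (s : ι →₀ ℕ) :
    ((gmSort s).map (X : ι → MvPolynomial ι K)).prod = monomial s 1 := by
  rw [← Multiset.prod_coe, ← Multiset.map_coe, gmSort, Multiset.sort_eq, Finsupp.toMultiset_map,
    Finsupp.prod_toMultiset, Finsupp.prod_mapDomain_index (by simp) (by simp [pow_add]),
    MvPolynomial.monomial_eq]
  simp

lemma gm_exists_poly (Q : List ι → Prop) (v : B)
    (hv : v ∈ Submodule.span K {v | ∃ l : List ι, l.Pairwise (· ≤ ·) ∧ Q l ∧ v = (l.map y).prod}) :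
    ∃ F : MvPolynomial ι K, gmSig K y F = v ∧ ∀ s ∈ F.support, Q (gmSort s) := by
  induction hv using Submodule.span_induction with
  | mem v hv =>
    obtain ⟨l, hl, hQ, rfl⟩ := hv
    refine ⟨monomial (Multiset.toFinsupp (l : Multiset ι)) 1, ?_, ?_⟩
    · rw [gmSig_monomial, gmSort_of_sorted l hl, one_smul]
    · intro s hs
      have := MvPolynomial.support_monomial_subset hs
      rw [Finset.mem_singleton] at this
      rw [this, gmSort_of_sorted l hl]
      exact hQ
  | zero => exact ⟨0, by simp⟩
  | add a b _ _ ha hb =>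
    obtain ⟨F, h1, h2⟩ := ha
    obtain ⟨G, h3, h4⟩ := hb
    classical
    refine ⟨F + G, by rw [map_add, h1, h3], fun s hs => ?_⟩
    rcases Finset.mem_union.mp (MvPolynomial.support_add hs) with h | h
    · exact h2 s h
    · exact h4 s h
  | smul c a _ ha =>
    obtain ⟨F, h1, h2⟩ := ha
    exact ⟨c • F, by rw [map_smul, h1], fun s hs => h2 s (MvPolynomial.support_smul hs)⟩

lemma gm_apply (T : B →ₗ[K] K) (d : ℕ) (F : MvPolynomial ι K) (hF : F.totalDegree ≤ d)
    (φ : MvPolynomial ι K →ₗ[K] K) (Q : List ι → Prop) (hQ : ∀ s ∈ F.support, Q (gmSort s))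
    (h1 : ∀ l, Q l → l.length < d → T (l.map y).prod = 0)
    (h2 : ∀ l, Q l → l.length = d → T (l.map y).prod = φ (l.map X).prod) :
    T (gmSig K y F) = φ (homogeneousComponent d F) := by
  conv_lhs => rw [F.as_sum]
  rw [homogeneousComponent_apply, map_sum, map_sum, map_sum, Finset.sum_filter]
  refine Finset.sum_congr rfl fun s hs => ?_
  rw [gmSig_monomial, map_smul]
  have hle : s.degree ≤ d := (MvPolynomial.le_totalDegree hs).trans hF
  split_ifs with h
  · rw [h2 _ (hQ s hs) (by rw [gmSort_length, h]), gmSort_prod, ← map_smul, smul_monomial]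
    simp
  · rw [h1 _ (hQ s hs) (by rw [gmSort_length]; omega), smul_zero]

lemma gm_top_ne (F : MvPolynomial ι K) (hF : F ≠ 0) :
    homogeneousComponent F.totalDegree F ≠ 0 := by
  obtain ⟨s, hs, hd⟩ := Finset.exists_mem_eq_sup F.support
    (by rwa [Finset.nonempty_iff_ne_empty, Ne, MvPolynomial.support_eq_empty])
    (fun s => s.degree)
  have hd' : F.totalDegree = s.degree := by rw [← hd]; rfl
  intro h0
  have := congrArg (coeff s) h0
  rw [coeff_homogeneousComponent, if_pos hd'.symm, coeff_zero] at this
  exact (MvPolynomial.mem_support_iff.mp hs) this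
end Sigma
end

section
open Module
set_option linter.unusedSectionVars false
section Comm
open MvPolynomial
variable {K : Type*} [Field K] {g : Type*} [LieRing g] [LieAlgebra K g]
  {ι : Type*} [LinearOrder ι]

/-- affine letters -/
noncomputable def gmY (b : ι → g) (c : ι → K) (i : ι) : UniversalEnvelopingAlgebra K g :=
  UniversalEnvelopingAlgebra.ι K (b i) + algebraMap K _ (c i)

lemma gmY_prod (b : ι → g) (c : ι → K) (l : List ι) :
    (l.map (gmY b c)).prod = gmWord (l.map fun i => (b i, c i)) := by
  rw [gmWord, List.map_map]; rfl

lemma gmWord_append (q l : List (g × K)) :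
    gmWord (q ++ l) = gmWord q * gmWord l := by
  rw [gmWord, List.map_append, List.prod_append]; rfl

section
attribute [local instance] LieRing.ofAssociativeRing
lemma gmY_comm (b : ι → g) (c : ι → K) (ξ : g) (i : ι) :
    UniversalEnvelopingAlgebra.ι K ξ * gmY b c i - gmY b c i * UniversalEnvelopingAlgebra.ι K ξ
      = UniversalEnvelopingAlgebra.ι K ⁅ξ, b i⁆ := by
  rw [LieHom.map_lie, LieRing.of_associative_ring_bracket, gmY, mul_add, add_mul,
    Algebra.commutes (c i)]
  abel
end

lemma gm_comm_test (b : ι → g) (c : ι → K) (lam : Dual K g) (n : ℕ)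
    (T : UniversalEnvelopingAlgebra K g →ₗ[K] K)
    (hT : ∀ l : List (g × K), (l.length < n → T (gmWord l) = 0) ∧
      (l.length = n → T (gmWord l) = n.factorial * (l.map fun a => lam a.1).prod))
    (ξ : g) (D : Derivation K (MvPolynomial ι K) (MvPolynomial ι K))
    (hD : ∀ i, eval (fun i => lam (b i)) (D (X i)) = lam ⁅ξ, b i⁆) (l : List ι) :
    ∀ q : List (g × K),
    (q.length + l.length < n → T (gmWord q * (UniversalEnvelopingAlgebra.ι K ξ * (l.map (gmY b c)).prod
      - (l.map (gmY b c)).prod * UniversalEnvelopingAlgebra.ι K ξ)) = 0) ∧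
    (q.length + l.length = n → T (gmWord q * (UniversalEnvelopingAlgebra.ι K ξ * (l.map (gmY b c)).prod
      - (l.map (gmY b c)).prod * UniversalEnvelopingAlgebra.ι K ξ)) =
      n.factorial * (q.map fun a => lam a.1).prod *
        eval (fun i => lam (b i)) (D (l.map X).prod)) := by
  induction l with
  | nil => intro q; simp
  | cons j t ih =>
    intro q
    have key : gmWord q * (UniversalEnvelopingAlgebra.ι K ξ * ((j :: t).map (gmY b c)).prod
      - ((j :: t).map (gmY b c)).prod * UniversalEnvelopingAlgebra.ι K ξ)
      = gmWord (q ++ (⁅ξ, b j⁆, 0) :: (t.map fun i => (b i, c i))) +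
        gmWord (q ++ [(b j, c j)]) * (UniversalEnvelopingAlgebra.ι K ξ * (t.map (gmY b c)).prod
      - (t.map (gmY b c)).prod * UniversalEnvelopingAlgebra.ι K ξ) := by
      have h1 : gmWord ((⁅ξ, b j⁆, (0:K)) :: (t.map fun i => (b i, c i))) =
          UniversalEnvelopingAlgebra.ι K ⁅ξ, b j⁆ * (t.map (gmY b c)).prod := by
        rw [gmY_prod, gmWord, gmWord, List.map_cons, List.prod_cons]; simp
      have h2 : gmWord [(b j, c j)] = gmY b c j := by simp [gmWord, gmY]
      rw [gmWord_append, gmWord_append, h1, h2, ← gmY_comm b c, List.map_cons, List.prod_cons]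
      noncomm_ring
    obtain ⟨i1, i2⟩ := ih (q ++ [(b j, c j)])
    rw [key, map_add]
    simp only [List.length_append, List.length_cons, List.length_nil] at i1 i2 ⊢
    constructor
    · intro hlt
      rw [i1 (by omega), (hT _).1 (by simp; omega), add_zero]
    · intro heq
      rw [i2 (by omega), (hT _).2 (by simp; omega)]
      have e1 : eval (fun i => lam (b i)) (t.map (X : ι → MvPolynomial ι K)).prod
          = (t.map fun i => lam (b i)).prod := by
        rw [map_list_prod, List.map_map]; congr 1; simp [Function.comp_def]
      simp only [List.map_append, List.map_cons, List.prod_append, List.prod_cons, List.map_map,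
        Derivation.leibniz, smul_eq_mul, map_add, map_mul, eval_X, hD, e1, Function.comp_def,
        List.map_nil, List.prod_nil]
      ring

lemma gmWord_test (b : ι → g) (c : ι → K) (lam : Dual K g) (n : ℕ)
    (T : UniversalEnvelopingAlgebra K g →ₗ[K] K)
    (hT : ∀ l : List (g × K), (l.length < n → T (gmWord l) = 0) ∧
      (l.length = n → T (gmWord l) = n.factorial * (l.map fun a => lam a.1).prod)) (l : List ι) :
    (l.length < n → T (l.map (gmY b c)).prod = 0) ∧
      (l.length = n → T (l.map (gmY b c)).prod =
        n.factorial * eval (fun i => lam (b i)) (l.map X).prod) := by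
  rw [gmY_prod]
  refine ⟨fun hl => (hT _).1 (by simpa using hl), fun hl => ?_⟩
  rw [(hT _).2 (by simpa using hl), map_list_prod, List.map_map, List.map_map]
  congr 2
  simp [Function.comp_def]

lemma gm_der_sum [Fintype ι] (L : ι → MvPolynomial ι K) (P : MvPolynomial ι K) :
    mkDerivation K L P = ∑ i, L i * pderiv i P := by
  have hs : ∀ Q, (∑ i, L i • pderiv (R := K) i : Derivation K (MvPolynomial ι K) (MvPolynomial ι K)) Q =
      ∑ i, L i * pderiv i Q := by
    intro Q
    rw [← Derivation.coeFnAddMonoidHom_apply, map_sum, Finset.sum_apply]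
    rfl
  rw [← hs]
  congr 1
  refine derivation_ext fun i => ?_
  rw [mkDerivation_X, hs, Finset.sum_eq_single i]
  · simp
  · intro j _ hj
    rw [pderiv_X_of_ne hj.symm, mul_zero]
  · simp

variable [FiniteDimensional K g] [IsAlgClosed K] [CharZero K] [LieAlgebra.IsKilling K g]

lemma gm_comm_vanish [Finite ι] (b : Basis ι K g) (c : ι → K) (M : Set ι) (F G : MvPolynomial ι K) (d : ℕ)
    (hF : F.totalDegree ≤ d) (ξ : g)
    (hG : UniversalEnvelopingAlgebra.ι K ξ * gmSig K (gmY b c) F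
      - gmSig K (gmY b c) F * UniversalEnvelopingAlgebra.ι K ξ = gmSig K (gmY b c) G)
    (hGM : ∀ s ∈ G.support, ∃ i ∈ gmSort s, i ∈ M)
    (L : ι → MvPolynomial ι K) [Fintype ι]
    (lam : Dual K g) (hlam : ∀ i ∈ M, lam (b i) = 0)
    (hL : ∀ i, eval (fun i => lam (b i)) (L i) = lam ⁅ξ, b i⁆) :
    eval (fun i => lam (b i)) (∑ i, L i * pderiv i (homogeneousComponent d F)) = 0 := by
  have main : ∀ (n : ℕ) (_ : F.totalDegree ≤ n) (lam : Dual K g) (L : ι → MvPolynomial ι K)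
      (_ : ∀ i, eval (fun i => lam (b i)) (L i) = lam ⁅ξ, b i⁆)
      (T : UniversalEnvelopingAlgebra K g →ₗ[K] K)
      (hT : ∀ l : List (g × K), (l.length < n → T (gmWord l) = 0) ∧
      (l.length = n → T (gmWord l) = n.factorial * (l.map fun a => lam a.1).prod)),
      T (gmSig K (gmY b c) G) = n.factorial * eval (fun i => lam (b i))
        (∑ i, L i * pderiv i (homogeneousComponent n F)) := by
    intro n hn lam L hL T hT
    have hc := gm_comm_test b c lam n T hT ξ (mkDerivation K L) (by intro i; rw [mkDerivation_X, hL])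
    have := gm_apply (gmY b c) (T ∘ₗ (LinearMap.mulLeft K (UniversalEnvelopingAlgebra.ι K ξ) -
        LinearMap.mulRight K (UniversalEnvelopingAlgebra.ι K ξ))) n F hn
      ((n.factorial : K) • ((aeval (fun i => lam (b i))).toLinearMap ∘ₗ
        (mkDerivation K L).toLinearMap)) (fun _ => True)
      (fun _ _ => trivial) ?_ ?_
    · rw [← hG, ← gm_der_sum]
      exact this
    · intro l _ hl
      have := (hc l []).1 (by simpa using hl)
      rw [gmWord, List.map_nil, List.prod_nil, one_mul] at this
      exact this
    · intro l _ hl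
      have := (hc l []).2 (by simpa using hl)
      rw [gmWord, List.map_nil, List.prod_nil, List.map_nil, List.prod_nil, one_mul, mul_one] at this
      exact this
  have hdeg : G.totalDegree ≤ d := by
    by_contra hcon
    push Not at hcon
    have hG0 : G ≠ 0 := by rintro rfl; simp at hcon
    refine gm_top_ne G hG0 (MvPolynomial.funext fun x => ?_)
    obtain ⟨T, hT⟩ := gm_test (b.constr K x : Dual K g) G.totalDegree
    set lam : Dual K g := b.constr K x
    have hx : x = fun i => lam (b i) := by ext i; simp [lam]
    have h1 := main G.totalDegree (by omega) lam (fun i => C (lam ⁅ξ, b i⁆)) (by simp) T hT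
    rw [homogeneousComponent_eq_zero _ _ (by omega)] at h1
    have h2 := gm_apply (gmY b c) T G.totalDegree G le_rfl
      ((G.totalDegree.factorial : K) • (aeval (fun i => lam (b i))).toLinearMap) (fun _ => True)
      (fun _ _ => trivial) (fun l _ => (gmWord_test b c lam _ T hT l).1)
      (fun l _ hl => by simpa [aeval_eq_eval] using (gmWord_test b c lam _ T hT l).2 hl)
    rw [h1] at h2
    simp only [map_zero, mul_zero, Finset.sum_const_zero, LinearMap.smul_apply, smul_eq_mul] at h2
    have := (mul_eq_zero.mp h2.symm).resolve_left (by exact_mod_cast Nat.factorial_ne_zero _)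
    rw [hx, map_zero]
    simpa [aeval_eq_eval] using this
  obtain ⟨T, hT⟩ := gm_test lam d
  have h1 := main d hF lam L hL T hT
  have h2 := gm_apply (gmY b c) T d G hdeg 0 (fun l => ∃ i ∈ l, i ∈ M) hGM
      (fun l _ => (gmWord_test b c lam _ T hT l).1)
      (fun l hl hd => by
        rw [(gmWord_test b c lam _ T hT l).2 hd, map_list_prod, List.map_map]
        obtain ⟨i, hi, hiM⟩ := hl
        rw [List.prod_eq_zero, mul_zero]; · rfl
        exact List.mem_map.mpr ⟨i, hi, by simp [hlam i hiM]⟩)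
  rw [h1, LinearMap.zero_apply] at h2
  exact (mul_eq_zero.mp h2).resolve_left (by exact_mod_cast Nat.factorial_ne_zero _)
end Comm

section Ideal
variable {K : Type*} [Field K] {ι : Type*} [LinearOrder ι] {B : Type*} [Ring B] [Algebra K B]

lemma gm_ideal {y : ι → B} (M : Set ι) (hM : ∀ i ∈ M, ∀ j, i ≤ j → j ∈ M)
    (hy : ∀ i ∈ M, ∀ j ∈ M, ∃ a ∈ Submodule.span K (y '' M), ∃ c : K,
      y i * y j - y j * y i = a + algebraMap K B c ∧ (True → c = 0))
    (x : B) (hx : x ∈ gmSS K y Set.univ False) (j : ι) (hj : j ∈ M) :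
    x * y j ∈ Submodule.span K {v | ∃ l : List ι, l.Pairwise (· ≤ ·) ∧ (∃ i ∈ l, i ∈ M) ∧
      v = (l.map y).prod} := by
  classical
  have main : ∀ l : List ι, l.Pairwise (· ≤ ·) → (l.map y).prod * y j ∈
      Submodule.span K {v | ∃ l' : List ι, l'.Pairwise (· ≤ ·) ∧ (∃ i ∈ l', i ∈ M) ∧
        (∀ k ∈ l', k ∈ M ∨ k ∈ l) ∧ v = (l'.map y).prod} := by
    intro l hl
    induction l with
    | nil => exact Submodule.subset_span ⟨[j], by simp, ⟨j, by simp, hj⟩, by simp [hj], by simp⟩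
    | cons i t ih =>
      rw [List.pairwise_cons] at hl
      by_cases hi : i ∈ M
      · have key : ∀ l : List ι, (∀ k ∈ l, k ∈ M) → (l.map y).prod * y j ∈ gmSS K y M True := by
          intro l hl
          induction l with
          | nil => exact Submodule.subset_span ⟨[j], by simp, by simpa using hj, by simp, by simp⟩
          | cons a s ih' =>
            rw [List.map_cons, List.prod_cons, mul_assoc]
            exact gm_mulS hy a (hl a (by simp)) _ (ih' fun k hk => hl k (by simp [hk]))
        have h1 := key (i :: t) (by
          intro k hk
          rcases List.mem_cons.mp hk with rfl | hk
          · exact hi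
          · exact hM i hi k (hl.1 k hk))
        refine Submodule.span_mono ?_ h1
        rintro v ⟨l, h1, h2, h3, h4⟩
        refine ⟨l, h1, ?_, fun k hk => Or.inl (h2 k hk), h4⟩
        obtain ⟨k, hk⟩ := List.exists_mem_of_ne_nil l (h3 trivial)
        exact ⟨k, hk, h2 k hk⟩
      · have := ih hl.2
        rw [List.map_cons, List.prod_cons, mul_assoc]
        generalize (t.map y).prod * y j = v at this
        induction this using Submodule.span_induction with
        | zero => simp
        | add a b _ _ ha hb => rw [mul_add]; exact add_mem ha hb
        | smul c a _ ha => rw [mul_smul_comm]; exact Submodule.smul_mem _ _ ha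
        | mem v hv =>
          obtain ⟨l, h1, ⟨k, hk, hkM⟩, h2, rfl⟩ := hv
          refine Submodule.subset_span ⟨i :: l, ?_, ⟨k, by simp [hk], hkM⟩, ?_, by simp⟩
          · rw [List.pairwise_cons]
            refine ⟨fun a ha => ?_, h1⟩
            rcases h2 a ha with h | h
            · by_contra hcon
              exact hi (hM a h i (le_of_not_ge hcon))
            · exact hl.1 a h
          · intro a ha
            rcases List.mem_cons.mp ha with rfl | ha
            · simp
            · rcases h2 a ha with h | h <;> simp [h]
  induction hx using Submodule.span_induction with
  | zero => simp
  | add a b _ _ ha hb => rw [add_mul]; exact add_mem ha hb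
  | smul c a _ ha => rw [smul_mul_assoc]; exact Submodule.smul_mem _ _ ha
  | mem v hv =>
    obtain ⟨l, hl, -, -, rfl⟩ := hv
    refine Submodule.span_mono ?_ (main l hl)
    rintro v ⟨l, h1, h2, -, h4⟩
    exact ⟨l, h1, h2, h4⟩
end Ideal
end

section
open Module
set_option linter.unusedSectionVars false
section Pd
open MvPolynomial
variable {K : Type*} [Field K] {ι : Type*}

lemma gm_eval_congr (P : MvPolynomial ι K) (x y : ι → K)
    (hxy : ∀ s ∈ P.support, ∀ i ∈ s.support, x i = y i) : eval x P = eval y P := by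
  rw [eval_eq, eval_eq]
  refine Finset.sum_congr rfl fun s hs => ?_
  congr 1
  exact Finset.prod_congr rfl fun i hi => by rw [hxy s hs i hi]

lemma gm_pderiv_support (P : MvPolynomial ι K) (Z : Set ι)
    (hP : ∀ s ∈ P.support, ∀ i ∈ s.support, i ∈ Z) (j : ι) :
    ∀ s ∈ (pderiv j P).support, ∀ i ∈ s.support, i ∈ Z := by
  intro s hs i hi
  rw [MvPolynomial.mem_support_iff, coeff_pderiv] at hs
  refine hP (s + Finsupp.single j 1) (MvPolynomial.mem_support_iff.mpr (left_ne_zero_of_mul hs)) i ?_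
  rw [Finsupp.mem_support_iff] at hi ⊢
  simp [hi]

lemma gm_pderiv_zero_of (P : MvPolynomial ι K) (j : ι)
    (hP : ∀ s ∈ P.support, j ∉ s.support) : pderiv j P = 0 := by
  refine pderiv_eq_zero_of_notMem_vars fun h => ?_
  obtain ⟨s, hs, hj⟩ := (mem_vars_iff_mem_support ..).mp h
  exact hP s hs hj

lemma gm_of_pderiv_zero [CharZero K] (P : MvPolynomial ι K) (j : ι) (hP : pderiv j P = 0) :
    ∀ s ∈ P.support, j ∉ s.support := by
  intro s hs hj
  have := congrArg (coeff (s - Finsupp.single j 1)) hP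
  have h1 : 1 ≤ s j := Nat.one_le_iff_ne_zero.mpr (Finsupp.mem_support_iff.mp hj)
  rw [coeff_pderiv, tsub_add_cancel_of_le (by simpa using h1), coeff_zero] at this
  rcases mul_eq_zero.mp this with h | h
  · exact MvPolynomial.mem_support_iff.mp hs h
  · exact absurd h (Nat.cast_add_one_ne_zero _)
end Pd

section Wt
open MvPolynomial
variable {K : Type*} [Field K] [CharZero K] {g : Type*} [LieRing g] [LieAlgebra K g]
  [FiniteDimensional K g] {ι : Type*} [Fintype ι] (b : Basis ι K g) (w : ι → ℤ) (h : g)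

lemma gm_eigenbasis [IsAlgClosed K] (e f : g) 
    (hhe : ⁅h, e⁆ = (2 : K) • e) (hhf : ⁅h, f⁆ = (-2 : K) • f) (hef : ⁅e, f⁆ = h) :
    ∃ (N : ℕ) (b : Basis (Fin N) K g) (w : Fin N → ℤ), Antitone w ∧
      ∀ i, ⁅h, b i⁆ = (w i : K) • b i := by
  have h0 := gm_sl2_diag (LieAlgebra.ad K g e) (LieAlgebra.ad K g f) (LieAlgebra.ad K g h)
    (by ext x; have := leibniz_lie h e x; simp [hhe] at this; simp [this])
    (by ext x; have := leibniz_lie h f x; simp [hhf] at this; simp [this])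
    (by ext x; have := leibniz_lie e f x; simp [hef] at this; simp [this])
  set S : Set g := {x | ∃ i : ℤ, ⁅h, x⁆ = (i : K) • x} with hS
  have hspan : ⊤ ≤ Submodule.span K S := by
    rw [← h0]
    refine iSup_le fun i x hx => Submodule.subset_span ⟨i, ?_⟩
    simpa using End.mem_eigenspace_iff.mp hx
  let b0 := Basis.ofSpan hspan
  have hb0 : ∀ i, ∃ k : ℤ, ⁅h, b0 i⁆ = (k : K) • b0 i := by
    intro i
    exact Basis.ofSpan_subset hspan ⟨i, rfl⟩
  choose w0 hw0 using hb0
  let eqv := b0.indexEquiv (Module.finBasis K g)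
  let v : Fin (finrank K g) → ℤ := fun i => - w0 (eqv.symm i)
  refine ⟨finrank K g, b0.reindex (eqv.trans (Tuple.sort v).symm),
    fun i => w0 (eqv.symm (Tuple.sort v i)), ?_, fun i => ?_⟩
  · intro i j hij
    have := Tuple.monotone_sort v hij
    exact neg_le_neg_iff.mp this
  · rw [Basis.reindex_apply]
    exact hw0 _

lemma gm_wt_repr (hb : ∀ i, ⁅h, b i⁆ = (w i : K) • b i) (x : g) (k : ℤ) (hx : ⁅h, x⁆ = (k : K) • x)
    (j : ι) (hj : w j ≠ k) : b.repr x j = 0 := by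
  have h1 : ⁅h, x⁆ = ∑ i, (b.repr x i * w i) • b i := by
    conv_lhs => rw [← b.sum_repr x]
    rw [lie_sum]
    simp [hb, mul_smul]
  have h2 : b.repr ⁅h, x⁆ j = b.repr x j * w j := by
    rw [h1, b.repr_sum_self]
  rw [hx, map_smul, Finsupp.smul_apply, smul_eq_mul] at h2
  have h3 : b.repr x j * ((w j : K) - k) = 0 := by rw [mul_sub, ← h2]; ring
  refine (mul_eq_zero.mp h3).resolve_right (sub_ne_zero.mpr ?_)
  exact_mod_cast hj

lemma gm_pderiv_zero [LieAlgebra.IsKilling K g] (hb : ∀ i, ⁅h, b i⁆ = (w i : K) • b i)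
    (f : MvPolynomial ι K) (hf : ∀ s ∈ f.support, ∀ i ∈ s.support, 0 ≤ w i)
    (H : ∀ k : ℤ, k < 0 → ∀ ξ : g, ⁅h, ξ⁆ = (k : K) • ξ → ∀ L : ι → MvPolynomial ι K,
      ∀ lam : Dual K g, (∀ i, w i < 0 → lam (b i) = 0) →
      (∀ i, eval (fun i => lam (b i)) (L i) = lam ⁅ξ, b i⁆) →
      eval (fun i => lam (b i)) (∑ i, L i * pderiv i f) = 0) :
    ∀ i, 0 < w i → pderiv i f = 0 := by
  classical
  let L : g → ι → MvPolynomial ι K := fun ξ i =>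
    ∑ k, if 0 ≤ w k then C (b.repr ⁅ξ, b i⁆ k) * X k else 0
  have hL : ∀ ξ i (lam : Dual K g), (∀ i, w i < 0 → lam (b i) = 0) →
      eval (fun i => lam (b i)) (L ξ i) = lam ⁅ξ, b i⁆ := by
    intro ξ i lam hlam
    conv_rhs => rw [← b.sum_repr ⁅ξ, b i⁆]
    rw [map_sum, map_sum]
    refine Finset.sum_congr rfl fun k _ => ?_
    rw [map_smul, smul_eq_mul]
    split_ifs with hk
    · simp
    · rw [hlam k (by omega)]; simp
  have hLc : ∀ ξ i (x y : ι → K), (∀ k, 0 ≤ w k → x k = y k) → eval x (L ξ i) = eval y (L ξ i) := by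
    intro ξ i x y hxy
    rw [map_sum, map_sum]
    refine Finset.sum_congr rfl fun k _ => ?_
    split_ifs with hk
    · simp [hxy k hk]
    · simp
  have key : ∀ k : ℤ, k < 0 → ∀ ξ : g, ⁅h, ξ⁆ = (k : K) • ξ →
      ∑ i : {i // 0 < w i}, L ξ i * pderiv i.1 f = 0 := by
    intro k hk ξ hξ
    have h1 : ∑ i, L ξ i * pderiv i f = 0 := by
      refine MvPolynomial.funext fun x => ?_
      let y : ι → K := fun i => if 0 ≤ w i then x i else 0
      let lam : Dual K g := b.constr K y
      have hlam : ∀ i, lam (b i) = y i := by intro i; simp [lam]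
      have hlam' : ∀ i, w i < 0 → lam (b i) = 0 := by
        intro i hi; rw [hlam]; simp [y, hi]
      have h2 := H k hk ξ hξ (L ξ) lam hlam' (fun i => hL ξ i lam hlam')
      have h3 : (fun i => lam (b i)) = y := _root_.funext hlam
      rw [h3] at h2
      rw [map_zero, ← h2, map_sum, map_sum]
      refine Finset.sum_congr rfl fun i _ => ?_
      rw [map_mul, map_mul]
      congr 1
      · exact hLc _ _ _ _ fun k hk => by simp [y, hk]
      · refine gm_eval_congr _ _ _ fun s hs j hj => ?_
        have : 0 ≤ w j := gm_pderiv_support f {i | 0 ≤ w i} hf i s hs j hj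
        simp [y, this]
    rw [← h1, ← Finset.sum_subtype (Finset.univ.filter fun i => 0 < w i) (by simp)
      (fun i => L ξ i * pderiv i f)]
    refine Finset.sum_filter_of_ne fun i _ hi => ?_
    by_contra hcon
    push Not at hcon
    rcases hcon.lt_or_eq with h0 | h0
    · refine right_ne_zero_of_mul hi (gm_pderiv_zero_of f i fun s hs his => ?_)
      have := hf s hs i his
      omega
    · refine left_ne_zero_of_mul hi (Finset.sum_eq_zero fun j _ => ?_)
      split_ifs with hj
      · rw [gm_wt_repr b w h hb ⁅ξ, b i⁆ k ?_ j (by omega)]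
        · simp
        · rw [leibniz_lie, hξ, hb, h0]
          simp
      · rfl
  let κ := killingForm K g
  have hinv : ∀ x y z : g, κ ⁅x, y⁆ z = κ x ⁅y, z⁆ := LieModule.traceForm_apply_lie_apply K g g
  have hnd : LinearMap.BilinForm.Nondegenerate κ := LieAlgebra.IsKilling.killingForm_nondegenerate K g
  let bs := LinearMap.BilinForm.dualBasis κ hnd b
  have hbs : ∀ i j, κ (bs i) (b j) = if j = i then 1 else 0 := 
    LinearMap.BilinForm.apply_dualBasis_left hnd b
  have hbw : ∀ i, ⁅h, bs i⁆ = ((-w i : ℤ) : K) • bs i := by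
    intro i
    have : κ ⁅h, bs i⁆ = κ (((-w i : ℤ) : K) • bs i) := by
      refine b.ext fun j => ?_
      rw [← lie_skew, map_neg, LinearMap.neg_apply, hinv, hb, map_smul, map_smul, 
        LinearMap.smul_apply, hbs]
      split_ifs with hij
      · simp [hij]
      · simp
    exact sub_eq_zero.mp (hnd.1 _ fun y => by rw [map_sub, this, sub_self, LinearMap.zero_apply])
  have hκ : ∀ i, w i < 0 → κ h (b i) = 0 := by
    intro i hi
    have h1 := hinv h h (b i)
    rw [lie_self, hb, map_smul, map_zero, LinearMap.zero_apply, smul_eq_mul] at h1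
    refine (mul_eq_zero.mp h1.symm).resolve_left ?_
    exact_mod_cast hi.ne
  let ξ : ι → g := fun i => (-(w i : K)⁻¹) • bs i
  let Nm : Matrix {i // 0 < w i} {i // 0 < w i} (MvPolynomial ι K) := fun i j => L (ξ i) j
  have hdet : Nm.det ≠ 0 := by
    intro h0
    have h1 := congrArg (eval (fun i => κ h (b i))) h0
    rw [RingHom.map_det, map_zero] at h1
    have h2 : (eval (fun i => κ h (b i))).mapMatrix Nm = 1 := by
      ext i j
      rw [RingHom.mapMatrix_apply, Matrix.map_apply, hL (ξ i) j (κ h) hκ, ← hinv]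
      simp only [ξ]
      have hi : (w i : K) ≠ 0 := by exact_mod_cast i.2.ne'
      rw [lie_smul, hbw, smul_smul]
      have : -(w i : K)⁻¹ * ((-w i : ℤ) : K) = 1 := by push_cast; field_simp
      rw [this, one_smul, hbs, Matrix.one_apply]
      simp [Subtype.ext_iff, eq_comm]
    rw [h2, Matrix.det_one] at h1
    exact one_ne_zero h1
  have hv := Matrix.eq_zero_of_mulVec_eq_zero hdet (v := fun j => pderiv j.1 f) (by
    ext1 i
    refine key (-w i) (by have := i.2; omega) (ξ i) ?_
    simp only [ξ]
    rw [lie_smul, hbw, smul_comm])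
  intro i hi
  exact congrFun hv ⟨i, hi⟩
end Wt
end

section
open Module
set_option linter.unusedSectionVars false
section SigHom
open MvPolynomial
variable {K : Type*} [Field K] {ι : Type*} [LinearOrder ι] {B B' : Type*} [Ring B] [Algebra K B]
  [Ring B'] [Algebra K B']
lemma gmSig_hom (φ : B →ₐ[K] B') (y : ι → B) (y' : ι → B') (F : MvPolynomial ι K)
    (hF : ∀ s ∈ F.support, ∀ i ∈ gmSort s, φ (y i) = y' i) :
    φ (gmSig K y F) = gmSig K y' F := by
  rw [F.as_sum, map_sum, map_sum, map_sum]
  refine Finset.sum_congr rfl fun s hs => ?_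
  rw [gmSig_monomial, gmSig_monomial, map_smul, map_list_prod, List.map_map]
  congr 2
  exact List.map_congr_left fun i hi => hF s hs i hi
end SigHom

section Main
open MvPolynomial
variable {K : Type*} [Field K] [CharZero K] {g : Type*} [LieRing g] [LieAlgebra K g]
  [FiniteDimensional K g] {ι : Type*} [Fintype ι] [LinearOrder ι] (b : Basis ι K g) (w : ι → ℤ) (h : g)

lemma gm_eig_span (hb : ∀ i, ⁅h, b i⁆ = (w i : K) • b i) (x : g) (k : ℤ)
    (hx : ⁅h, x⁆ = (k : K) • x) (Z : Set ι) (hZ : ∀ i, w i = k → i ∈ Z) :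
    x ∈ Submodule.span K (b '' Z) := by
  rw [← b.sum_repr x]
  refine Submodule.sum_mem _ fun i _ => ?_
  by_cases hi : w i = k
  · exact Submodule.smul_mem _ _ (Submodule.subset_span ⟨i, hZ i hi, rfl⟩)
  · rw [gm_wt_repr b w h hb x k hx i hi, zero_smul]; exact zero_mem _

lemma gm_lie_wt (hb : ∀ i, ⁅h, b i⁆ = (w i : K) • b i) (i j : ι) :
    ⁅h, ⁅b i, b j⁆⁆ = ((w i + w j : ℤ) : K) • ⁅b i, b j⁆ := by
  rw [leibniz_lie, hb, hb, smul_lie, lie_smul, ← add_smul]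
  push_cast
  rfl

section
attribute [local instance] LieRing.ofAssociativeRing
/-- the shifted inclusion -/
noncomputable def gmShift (χ : Dual K g) : g →ₗ[K] UniversalEnvelopingAlgebra K g :=
  (UniversalEnvelopingAlgebra.ι K : g →ₗ⁅K⁆ UniversalEnvelopingAlgebra K g).toLinearMap -
    (Algebra.linearMap K _) ∘ₗ χ

lemma gmShift_apply (χ : Dual K g) (x : g) : gmShift χ x = UniversalEnvelopingAlgebra.ι K x -
    algebraMap K _ (χ x) := rfl
end

lemma gmShift_basis (χ : Dual K g) (i : ι) : gmShift χ (b i) = gmY b (fun i => - χ (b i)) i := by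
  rw [gmShift_apply, gmY, map_neg, sub_eq_add_neg]

lemma gmShift_mem (χ : Dual K g) (Z : Set ι) (x : g) (hx : x ∈ Submodule.span K (b '' Z)) :
    gmShift χ x ∈ Submodule.span K (gmY b (fun i => - χ (b i)) '' Z) := by
  have := Submodule.mem_map_of_mem (f := gmShift χ) hx
  rw [Submodule.map_span, ← Set.image_comp] at this
  have h2 : (gmShift χ ∘ b : ι → _) = gmY b (fun i => - χ (b i)) :=
    _root_.funext fun i => gmShift_basis b χ i
  rwa [h2] at this

lemma gm_hy (hb : ∀ i, ⁅h, b i⁆ = (w i : K) • b i) (χ : Dual K g) (Z : Set ι)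
    (hZ : ∀ i ∈ Z, ∀ j ∈ Z, ∀ k, w k = w i + w j → k ∈ Z) (i : ι) (hi : i ∈ Z) (j : ι) (hj : j ∈ Z) :
    ∃ a ∈ Submodule.span K (gmY b (fun i => - χ (b i)) '' Z),
      gmY b (fun i => - χ (b i)) i * gmY b (fun i => - χ (b i)) j -
        gmY b (fun i => - χ (b i)) j * gmY b (fun i => - χ (b i)) i = a +
        algebraMap K _ (χ ⁅b i, b j⁆) := by
  refine ⟨gmShift χ ⁅b i, b j⁆, gmShift_mem b χ Z _ (gm_eig_span b w h hb _ _
    (gm_lie_wt b w h hb i j) Z (hZ i hi j hj)), ?_⟩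
  rw [gmShift_apply, sub_add_cancel, ← gmY_comm b (fun i => - χ (b i))]
  conv_lhs => rw [gmY.eq_def b _ i]
  rw [add_mul, mul_add, Algebra.commutes (- χ (b i))]
  abel

lemma gm_ideal' (hb : ∀ i, ⁅h, b i⁆ = (w i : K) • b i) (hw : Antitone w) (χ : Dual K g)
    (hχ : ∀ i j, w i < 0 → w j < 0 → χ ⁅b i, b j⁆ = 0) (m : Submodule K g)
    (hm : m ≤ Submodule.span K (b '' {i | w i < 0})) (x : UniversalEnvelopingAlgebra K g)
    (hx : x ∈ Submodule.span (UniversalEnvelopingAlgebra K g)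
      {u : UniversalEnvelopingAlgebra K g | ∃ ξ ∈ m,
        u = UniversalEnvelopingAlgebra.ι K ξ - algebraMap K _ (χ ξ)}) :
    ∃ G : MvPolynomial ι K, gmSig K (gmY b (fun i => - χ (b i))) G = x ∧
      ∀ s ∈ G.support, ∃ i ∈ gmSort s, i ∈ {i | w i < 0} := by
  refine gm_exists_poly (gmY b (fun i => - χ (b i))) (fun l => ∃ i ∈ l, i ∈ {i | w i < 0}) x ?_
  suffices hs : ∀ a : UniversalEnvelopingAlgebra K g, a * x ∈ Submodule.span K
      {v | ∃ l : List ι, l.Pairwise (· ≤ ·) ∧ (∃ i ∈ l, i ∈ {i | w i < 0}) ∧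
        v = (l.map (gmY b (fun i => - χ (b i)))).prod} by
    simpa using hs 1
  induction hx using Submodule.span_induction with
  | zero => simp
  | add x y _ _ hx hy => intro a; rw [mul_add]; exact add_mem (hx a) (hy a)
  | smul r x _ hx => intro a; rw [smul_eq_mul, ← mul_assoc]; exact hx _
  | mem x hx =>
    obtain ⟨ξ, hξ, rfl⟩ := hx
    intro a
    rw [← gmShift_apply]
    have h1 := gmShift_mem b χ _ ξ (hm hξ)
    have ha : a ∈ gmSS K (gmY b (fun i => - χ (b i))) Set.univ False := by
      refine gm_adjoin_le (K := K) (fun i _ j _ => ?_) (Set.range (UniversalEnvelopingAlgebra.ι K : g → _)) ?_ a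
        (by rw [gm_adjoin_top]; trivial)
      · obtain ⟨a, ha, h⟩ := gm_hy b w h hb χ Set.univ (by simp) i trivial j trivial
        exact ⟨a, ha, _, h⟩
      · rintro _ ⟨x, rfl⟩
        refine ⟨gmShift χ x, gmShift_mem b χ _ x (by simp), χ x, ?_⟩
        rw [gmShift_apply, sub_add_cancel]
    generalize gmShift χ ξ = z at h1
    induction h1 using Submodule.span_induction with
    | zero => simp
    | add x y _ _ hx hy => rw [mul_add]; exact add_mem hx hy
    | smul r x _ hx => rw [mul_smul_comm]; exact Submodule.smul_mem _ _ hx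
    | mem x hx =>
      obtain ⟨j, hj, rfl⟩ := hx
      refine gm_ideal {i | w i < 0} (fun i hi j hij => lt_of_le_of_lt (hw hij) hi) (fun i hi j hj => ?_) a ha j hj
      obtain ⟨a, ha, h⟩ := gm_hy b w h hb χ {i | w i < 0} (by
        intro i hi j hj k hk
        simp only [Set.mem_setOf_eq] at *
        omega) i hi j hj
      exact ⟨a, ha, _, h, fun _ => hχ i j hi hj⟩

lemma gm_core [IsAlgClosed K] [LieAlgebra.IsKilling K g]
    (hb : ∀ i, ⁅h, b i⁆ = (w i : K) • b i) (hw : Antitone w) (χ : Dual K g)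
    (hχ : ∀ i j, w i < 0 → w j < 0 → χ ⁅b i, b j⁆ = 0) (p m : Submodule K g)
    (hm : m ≤ Submodule.span K (b '' {i | w i < 0}))
    (hm' : ∀ k : ℤ, k < 0 → ∀ ξ : g, ⁅h, ξ⁆ = (k : K) • ξ → ξ ∈ m)
    (hp : p ≤ Submodule.span K (b '' {i | 0 ≤ w i}))
    (A : Subalgebra K (UniversalEnvelopingAlgebra K g))
    (hA : A = Algebra.adjoin K (⇑(UniversalEnvelopingAlgebra.ι K) '' (p : Set g)))
    (hpA : ∀ i, 0 ≤ w i → UniversalEnvelopingAlgebra.ι K (b i) ∈ A)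
    (Ψ : A →ₐ[K] UniversalEnvelopingAlgebra K g)
    (hΨ : ∀ i (hi : 0 ≤ w i), Ψ ⟨_, hpA i hi⟩ = 
      UniversalEnvelopingAlgebra.ι K (if w i = 0 then b i else 0))
    (u : A) (hu : ∀ ξ ∈ m, UniversalEnvelopingAlgebra.ι K ξ * (u : UniversalEnvelopingAlgebra K g) -
        (u : UniversalEnvelopingAlgebra K g) * UniversalEnvelopingAlgebra.ι K ξ ∈
        Submodule.span (UniversalEnvelopingAlgebra K g)
      {u : UniversalEnvelopingAlgebra K g | ∃ ξ ∈ m,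
        u = UniversalEnvelopingAlgebra.ι K ξ - algebraMap K _ (χ ξ)})
    (hu0 : Ψ u = 0) : u = 0 := by
  set c : ι → K := fun i => - χ (b i) with hc
  obtain ⟨F, hFu, hFs⟩ : ∃ F : MvPolynomial ι K, gmSig K (gmY b c) F = u ∧
      ∀ s ∈ F.support, ∀ i ∈ gmSort s, 0 ≤ w i := by
    refine gm_exists_poly (gmY b c) (fun l => ∀ i ∈ l, 0 ≤ w i) u ?_
    have h1 : (u : UniversalEnvelopingAlgebra K g) ∈ gmSS K (gmY b c) {i | 0 ≤ w i} False := by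
      refine gm_adjoin_le (fun i hi j hj => ?_) (⇑(UniversalEnvelopingAlgebra.ι K) '' (p : Set g)) ?_ _
        (by rw [← hA]; exact u.2)
      · obtain ⟨a, ha, h⟩ := gm_hy b w h hb χ {i | 0 ≤ w i} (by
          intro i hi j hj k hk
          simp only [Set.mem_setOf_eq] at *
          omega) i hi j hj
        exact ⟨a, ha, _, h⟩
      · rintro _ ⟨x, hx, rfl⟩
        refine ⟨gmShift χ x, gmShift_mem b χ _ x (hp hx), χ x, ?_⟩
        rw [gmShift_apply, sub_add_cancel]
    refine Submodule.span_mono ?_ h1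
    rintro v ⟨l, h1, h2, -, h4⟩
    exact ⟨l, h1, h2, h4⟩
  have hFs' : ∀ s ∈ F.support, ∀ i ∈ s.support, 0 ≤ w i := fun s hs i hi =>
    hFs s hs i ((gmSort_mem s i).mpr hi)
  suffices hF0 : F = 0 by
    apply Subtype.ext
    rw [← hFu, hF0, map_zero]; rfl
  by_contra hF0
  set f := homogeneousComponent F.totalDegree F with hf
  have hfs : ∀ s ∈ f.support, s ∈ F.support := by
    intro s hs
    rw [MvPolynomial.mem_support_iff, hf, coeff_homogeneousComponent] at hs
    rw [MvPolynomial.mem_support_iff]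
    intro h0
    apply hs
    rw [h0, ite_self]
  have hpd := gm_pderiv_zero b w h hb f (fun s hs => hFs' s (hfs s hs)) (by
    intro k hk ξ hξ L lam hlam hL
    have h1 := hu ξ (hm' k hk ξ hξ)
    obtain ⟨G, hG, hGM⟩ := gm_ideal' b w h hb hw χ hχ m hm _ h1
    refine gm_comm_vanish b c {i | w i < 0} F G F.totalDegree le_rfl ξ ?_ hGM L lam hlam hL
    rw [hFu]
    exact hG.symm)
  refine gm_top_ne F hF0 (MvPolynomial.funext fun x => ?_)
  let b0 : ι → g := fun i => if w i = 0 then b i else 0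
  have hz : gmSig K (gmY b0 c) F = 0 := by
    have hmemA : ∀ i, 0 ≤ w i → gmY b c i ∈ A := fun i hi =>
      add_mem (hpA i hi) (A.algebraMap_mem _)
    let yA : ι → A := fun i => if hi : 0 ≤ w i then ⟨gmY b c i, hmemA i hi⟩ else 0
    have h1 : A.val (gmSig K yA F) = gmSig K (gmY b c) F := by
      refine gmSig_hom A.val yA (gmY b c) F fun s hs i hi => ?_
      simp only [yA, dif_pos (hFs s hs i hi)]
      rfl
    have h2 : gmSig K yA F = u := Subtype.ext (h1.trans hFu)
    have h3 : Ψ (gmSig K yA F) = gmSig K (gmY b0 c) F := by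
      refine gmSig_hom Ψ yA (gmY b0 c) F fun s hs i hi => ?_
      have hi' := hFs s hs i hi
      simp only [yA, dif_pos hi']
      have : (⟨gmY b c i, hmemA i hi'⟩ : A) = ⟨_, hpA i hi'⟩ + algebraMap K A (c i) := rfl
      rw [this, map_add, hΨ i hi', AlgHom.commutes, gmY]
    rw [← h3, h2, hu0]
  set lam : Dual K g := b.constr K x
  have hx : ∀ i, lam (b i) = x i := by intro i; simp [lam]
  obtain ⟨T, hT⟩ := gm_test lam F.totalDegree
  have h2 := gm_apply (gmY b0 c) T F.totalDegree F le_rfl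
      ((F.totalDegree.factorial : K) • (aeval (fun i => lam (b0 i))).toLinearMap) (fun _ => True)
      (fun _ _ => trivial) (fun l _ => (gmWord_test b0 c lam _ T hT l).1)
      (fun l _ hl => by simpa [aeval_eq_eval] using (gmWord_test b0 c lam _ T hT l).2 hl)
  rw [hz, map_zero, ← hf] at h2
  have h3 : eval (fun i => lam (b0 i)) f = 0 :=
    (mul_eq_zero.mp h2.symm).resolve_left (by exact_mod_cast Nat.factorial_ne_zero _)
  rw [map_zero, ← h3]
  refine gm_eval_congr _ _ _ fun s hs i hi => ?_
  have h4 := hFs' s (hfs s hs) i hi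
  have h5 : w i = 0 := by
    by_contra hcon
    exact gm_of_pderiv_zero f i (hpd i (by omega)) s hs hi
  simp [b0, h5, hx]
end Main
end

section
attribute [local instance] LieRing.ofAssociativeRing
/-- functoriality for a subalgebra -/
noncomputable def gmLift {K g : Type*} [Field K] [LieRing g] [LieAlgebra K g]
    (S : LieSubalgebra K g) :
    UniversalEnvelopingAlgebra K S →ₐ[K] UniversalEnvelopingAlgebra K g :=
  UniversalEnvelopingAlgebra.lift K ((UniversalEnvelopingAlgebra.ι K).comp S.incl)

lemma gmLift_apply {K g : Type*} [Field K] [LieRing g] [LieAlgebra K g]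
    (S : LieSubalgebra K g) (x : S) :
    gmLift S (UniversalEnvelopingAlgebra.ι K x) = UniversalEnvelopingAlgebra.ι K (x : g) := by
  rw [gmLift, UniversalEnvelopingAlgebra.lift_ι_apply]
  rfl
end

/-- STATEMENT 14 (Generalized Miura transform is injective.) Assume `e` is even, i.e.
`g(i) = 0` for every odd `i`; set `p := ⊕_{i ≥ 0} g(i)` and `m := ⊕_{i < 0} g(i)`. Since
`⊕_{i > 0} g(i)` is a Lie ideal of `p`, the Lie algebra projection `p → g(0)` induces an
algebra homomorphism `U(p) → U(g(0))`, where `U(p) ⊆ U` is the subalgebra generated by `p`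
(any algebra homomorphism `Φ : U(p) → U(g(0))` that is the identity on `g(0)` and kills the
positive weight spaces is this induced homomorphism). Then the restriction of this
homomorphism to the subspace `W := {u ∈ U(p) : [ξ, u] ∈ U·m_χ for all ξ ∈ m}` is
injective. -/
theorem generalized_miura_transform_injective
    (K : Type*) [Field K] [IsAlgClosed K] [CharZero K]
    (g : Type*) [LieRing g] [LieAlgebra K g] [FiniteDimensional K g]
    [LieAlgebra.IsSemisimple K g]
    (e h f : g) (he : e ≠ 0)
    (hhe : ⁅h, e⁆ = (2 : K) • e) (hhf : ⁅h, f⁆ = (-2 : K) • f) (hef : ⁅e, f⁆ = h)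
    (heven : ∀ i : ℤ, Odd i →
      Module.End.eigenspace (LieAlgebra.ad K g h) (i : K) = ⊥)
    (p m : Submodule K g)
    (hp : p = ⨆ i : ℤ, ⨆ _ : 0 ≤ i,
      Module.End.eigenspace (LieAlgebra.ad K g h) (i : K))
    (hm : m = ⨆ i : ℤ, ⨆ _ : i < 0,
      Module.End.eigenspace (LieAlgebra.ad K g h) (i : K))
    (I : Submodule (UniversalEnvelopingAlgebra K g) (UniversalEnvelopingAlgebra K g))
    (hI : I = Submodule.span (UniversalEnvelopingAlgebra K g)
      {u : UniversalEnvelopingAlgebra K g | ∃ ξ ∈ m,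
        u = UniversalEnvelopingAlgebra.ι K ξ -
          algebraMap K (UniversalEnvelopingAlgebra K g) (killingForm K g e ξ)})
    -- `U(p)`, the subalgebra of `U` generated by `p`
    (A : Subalgebra K (UniversalEnvelopingAlgebra K g))
    (hA : A = Algebra.adjoin K (⇑(UniversalEnvelopingAlgebra.ι K) '' (p : Set g)))
    -- the algebra homomorphism `U(p) → U(g(0))` induced by the projection `p → g(0)`:
    (Φ : A →ₐ[K] UniversalEnvelopingAlgebra K (gZero K g h))
    (hΦzero : ∀ (x : gZero K g h)
      (hmem : UniversalEnvelopingAlgebra.ι K (x : g) ∈ A),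
      Φ ⟨UniversalEnvelopingAlgebra.ι K (x : g), hmem⟩ = UniversalEnvelopingAlgebra.ι K x)
    (hΦpos : ∀ i : ℤ, 0 < i →
      ∀ x ∈ Module.End.eigenspace (LieAlgebra.ad K g h) (i : K),
      ∀ hmem : UniversalEnvelopingAlgebra.ι K x ∈ A,
      Φ ⟨UniversalEnvelopingAlgebra.ι K x, hmem⟩ = 0) :
    -- the restriction of `Φ` to `W` is injective:
    Set.InjOn Φ {u : A | ∀ ξ ∈ m,
      UniversalEnvelopingAlgebra.ι K ξ * (u : UniversalEnvelopingAlgebra K g) -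
        (u : UniversalEnvelopingAlgebra K g) * UniversalEnvelopingAlgebra.ι K ξ ∈ I} := by
  classical
  have hkill : LieAlgebra.IsKilling K g := inferInstance
  obtain ⟨N, b, w, hw, hb⟩ := gm_eigenbasis (K := K) h e f hhe hhf hef
  have heig : ∀ (k : ℤ) (x : g), x ∈ Module.End.eigenspace (LieAlgebra.ad K g h) (k : K) ↔
      ⁅h, x⁆ = (k : K) • x := by
    intro k x
    rw [Module.End.mem_eigenspace_iff, LieAlgebra.ad_apply]
  have hweven : ∀ i, Even (w i) := by
    intro i
    rw [← Int.not_odd_iff_even]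
    intro ho
    have h1 := (heig (w i) (b i)).mpr (hb i)
    rw [heven _ ho, Submodule.mem_bot] at h1
    exact b.ne_zero i h1
  have hχw : ∀ (k : ℤ) (x : g), ⁅h, x⁆ = (k : K) • x → k ≠ -2 → killingForm K g e x = 0 := by
    intro k x hx hk
    have h1 : killingForm K g ⁅e, h⁆ x = killingForm K g e ⁅h, x⁆ :=
      LieModule.traceForm_apply_lie_apply K g g e h x
    rw [← lie_skew, hhe, hx, map_neg, map_smul, map_smul, LinearMap.neg_apply,
      LinearMap.smul_apply, smul_eq_mul, smul_eq_mul] at h1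
    have h2 : ((k : K) + 2) * killingForm K g e x = 0 := by linear_combination -h1
    refine (mul_eq_zero.mp h2).resolve_left ?_
    have : k + 2 ≠ 0 := by omega
    exact_mod_cast this
  have hχ : ∀ i j, w i < 0 → w j < 0 → killingForm K g e ⁅b i, b j⁆ = 0 := by
    intro i j hi hj
    refine hχw _ _ (gm_lie_wt b w h hb i j) ?_
    obtain ⟨a, ha⟩ := hweven i
    obtain ⟨c, hc⟩ := hweven j
    omega
  have hp' : p ≤ Submodule.span K (b '' {i | 0 ≤ w i}) := by
    rw [hp]
    refine iSup₂_le fun k hk x hx => ?_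
    exact gm_eig_span b w h hb x k ((heig k x).mp hx) _ fun i hi => by
      simp only [Set.mem_setOf_eq]; omega
  have hm1 : m ≤ Submodule.span K (b '' {i | w i < 0}) := by
    rw [hm]
    refine iSup₂_le fun k hk x hx => ?_
    exact gm_eig_span b w h hb x k ((heig k x).mp hx) _ fun i hi => by
      simp only [Set.mem_setOf_eq]; omega
  have hm2 : ∀ k : ℤ, k < 0 → ∀ ξ : g, ⁅h, ξ⁆ = (k : K) • ξ → ξ ∈ m := by
    intro k hk ξ hξ
    rw [hm]
    exact Submodule.mem_iSup_of_mem k (Submodule.mem_iSup_of_mem hk ((heig k ξ).mpr hξ))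
  have hpA : ∀ i, 0 ≤ w i → UniversalEnvelopingAlgebra.ι K (b i) ∈ A := by
    intro i hi
    rw [hA]
    refine Algebra.subset_adjoin ⟨b i, ?_, rfl⟩
    rw [hp]
    exact Submodule.mem_iSup_of_mem (w i) (Submodule.mem_iSup_of_mem hi ((heig _ _).mpr (hb i)))
  let Ψ : A →ₐ[K] UniversalEnvelopingAlgebra K g :=
    (gmLift (gZero K g h)).comp Φ
  have hΨ : ∀ i (hi : 0 ≤ w i), Ψ ⟨_, hpA i hi⟩ =
      UniversalEnvelopingAlgebra.ι K (if w i = 0 then b i else 0) := by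
    intro i hi
    show gmLift (gZero K g h) (Φ _) = _
    by_cases h0 : w i = 0
    · have hz : b i ∈ gZero K g h := (heig 0 (b i)).mpr (by rw [hb, h0])
      rw [if_pos h0]
      have := hΦzero ⟨b i, hz⟩ (hpA i hi)
      rw [this, gmLift_apply]
    · rw [if_neg h0, hΦpos (w i) (by omega) (b i) ((heig _ _).mpr (hb i)) (hpA i hi), map_zero,
        map_zero]
  intro u hu v hv huv
  refine sub_eq_zero.mp (gm_core b w h hb hw (killingForm K g e) hχ p m hm1 hm2 hp' A hA hpA Ψ hΨ
    (u - v) ?_ ?_)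
  · intro ξ hξ
    have := I.sub_mem (hu ξ hξ) (hv ξ hξ)
    rw [hI] at this
    convert this using 1
    push_cast
    noncomm_ring
  · show gmLift (gZero K g h) (Φ (u - v)) = 0
    rw [map_sub, huv, sub_self, map_zero]
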